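/- arXiv:2311.00075 — 2 statements merged into one kernel-verified Lean document; each statement's English description precedes it below -/
import Mathlib

section
/- In any graph G with maximum degree at most d, the number of connected vertex subsets of size k is at most n · (e·d)^{k} (more precisely, at most n·(k−1)!·C(dk, k−1)/k ≤ n·(ed)^{k−1}), hence for fixed d the number of connected k-subsets grows at most singly exponentially in k, linearly in n. -/
open SimpleGraph

lemma aux_crossing {V : Type*} (G : SimpleGraph V) (A S : Finset V) (v w : V)
    (hvA : v ∈ A) (hvS : v ∈ S) (hwS : w ∈ S) (hwA : w ∉ A)
    (hc : (G.induce (S : Set V)).Connected) :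
    ∃ a ∈ A, ∃ u ∈ S, u ∉ A ∧ G.Adj a u := by
  obtain ⟨p⟩ := hc.preconnected ⟨v, hvS⟩ ⟨w, hwS⟩
  obtain ⟨x, -, h1, h2⟩ := p.exists_boundary_dart {x | x.1 ∈ A} hvA hwA
  exact ⟨x.fst.1, h1, x.snd.1, x.snd.2, h2, x.adj⟩

open Classical in
lemma aux_count {V : Type*} [Fintype V] (G : SimpleGraph V)
    (d : ℕ) (hdeg : ∀ v, (G.neighborFinset v).card ≤ d) (v : V) (m : ℕ) :
    ∀ (r : ℕ) (A B : Finset V), v ∈ A →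
      A ∪ B ⊆ insert v (A.biUnion fun a => G.neighborFinset a) →
      (A ∪ B).card + m = d * (A.card + r) + 1 →
      (Finset.univ.filter fun S : Finset V => A ⊆ S ∧ Disjoint S B ∧ S.card = A.card + r ∧
        (G.induce (S : Set V)).Connected).card ≤ m.choose r := by
  induction m with
  | zero =>
    intro r A B hv hAB hm
    rcases r with _ | r
    · rw [Nat.choose_zero_right, Finset.card_le_one]
      intro S hS T hT
      simp only [Finset.mem_filter, Finset.mem_univ, true_and] at hS hT
      rw [← Finset.eq_of_subset_of_card_le hS.1 (by omega),
        ← Finset.eq_of_subset_of_card_le hT.1 (by omega)]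
    · rw [Nat.choose_zero_succ, Nat.le_zero, Finset.card_eq_zero, Finset.filter_eq_empty_iff]
      rintro S - ⟨hAS, hSB, hcard, hc⟩
      obtain ⟨w, hwS, hwA⟩ := Finset.exists_mem_notMem_of_card_lt_card
        (show A.card < S.card by omega)
      obtain ⟨a, ha, u, hu, huA, hadj⟩ := aux_crossing G A S v w hv (hAS hv) hwS hwA hc
      have huB : u ∉ B := Finset.disjoint_left.1 hSB hu
      have h1 : insert u (A ∪ B) ⊆ insert v (A.biUnion fun a => G.neighborFinset a) := by
        apply Finset.insert_subset _ hAB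
        refine Finset.mem_insert_of_mem (Finset.mem_biUnion.2 ⟨a, ha, by simpa using hadj⟩)
      have h2 := Finset.card_le_card h1
      rw [Finset.card_insert_of_notMem (by simp [huA, huB])] at h2
      have h3 := Finset.card_insert_le v (A.biUnion fun a => G.neighborFinset a)
      have h4 : (A.biUnion fun a => G.neighborFinset a).card ≤ A.card * d :=
        Finset.card_biUnion_le_card_mul _ _ _ fun a _ => hdeg a
      nlinarith
  | succ m ih =>
    intro r A B hv hAB hm
    rcases r with _ | r
    · rw [Nat.choose_zero_right, Finset.card_le_one]
      intro S hS T hT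
      simp only [Finset.mem_filter, Finset.mem_univ, true_and] at hS hT
      rw [← Finset.eq_of_subset_of_card_le hS.1 (by omega),
        ← Finset.eq_of_subset_of_card_le hT.1 (by omega)]
    · by_cases hex : ∃ a ∈ A, ∃ u, u ∉ A ∧ u ∉ B ∧ G.Adj a u
      · obtain ⟨a, ha, u, huA, huB, hadj⟩ := hex
        have huN : u ∈ insert v (A.biUnion fun a => G.neighborFinset a) :=
          Finset.mem_insert_of_mem (Finset.mem_biUnion.2 ⟨a, ha, by simpa using hadj⟩)
        have hc : (insert u (A ∪ B)).card = (A ∪ B).card + 1 :=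
          Finset.card_insert_of_notMem (by simp [huA, huB])
        have hcA : (insert u A).card = A.card + 1 := Finset.card_insert_of_notMem huA
        have e1 : insert u A ∪ B = insert u (A ∪ B) := Finset.insert_union _ _ _
        have e2 : A ∪ insert u B = insert u (A ∪ B) := Finset.union_insert _ _ _
        have hsub := Finset.insert_subset huN hAB
        have i1 := ih r (insert u A) B (Finset.mem_insert_of_mem hv)
          (by
            rw [e1]
            exact hsub.trans (Finset.insert_subset_insert _
              (Finset.biUnion_subset_biUnion_of_subset_left _ (Finset.subset_insert _ _))))
          (by
            rw [e1, hc, hcA]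
            have : A.card + 1 + r = A.card + (r + 1) := by ring
            rw [this]; omega)
        have i2 := ih (r + 1) A (insert u B) hv (by rw [e2]; exact hsub) (by rw [e2, hc]; omega)
        rw [Nat.choose_succ_succ]
        refine le_trans (le_trans (Finset.card_le_card ?_) (Finset.card_union_le _ _))
          (add_le_add i1 i2)
        intro S hS
        simp only [Finset.mem_filter, Finset.mem_univ, true_and, Finset.mem_union] at hS ⊢
        obtain ⟨hAS, hSB, hcard, hc⟩ := hS
        by_cases huS : u ∈ S
        · left
          exact ⟨Finset.insert_subset huS hAS, hSB, by omega, hc⟩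
        · right
          exact ⟨hAS, Finset.disjoint_insert_right.2 ⟨huS, hSB⟩, hcard, hc⟩
      · refine le_trans (le_of_eq ?_) (Nat.zero_le _)
        rw [Finset.card_eq_zero, Finset.filter_eq_empty_iff]
        rintro S - ⟨hAS, hSB, hcard, hc⟩
        obtain ⟨w, hwS, hwA⟩ := Finset.exists_mem_notMem_of_card_lt_card
          (show A.card < S.card by omega)
        obtain ⟨a, ha, u, hu, huA, hadj⟩ := aux_crossing G A S v w hv (hAS hv) hwS hwA hc
        exact hex ⟨a, ha, u, huA, Finset.disjoint_left.1 hSB hu, hadj⟩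

lemma aux_exp (n : ℕ) : ((n : ℝ) + 1) ^ n ≤ Real.exp 1 ^ n * (n.factorial : ℝ) := by
  induction n with
  | zero => simp
  | succ n ih =>
    have hpos : (0 : ℝ) < n + 1 := by positivity
    have h1 : ((n : ℝ) + 2) / (n + 1) ≤ Real.exp (1 / (n + 1)) := by
      have := Real.add_one_le_exp (1 / ((n : ℝ) + 1))
      refine le_trans (le_of_eq ?_) this
      field_simp
      ring
    have h2 : (((n : ℝ) + 2) / (n + 1)) ^ (n + 1) ≤ Real.exp 1 := by
      refine (pow_le_pow_left₀ (by positivity) h1 (n + 1)).trans (le_of_eq ?_)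
      rw [← Real.exp_nat_mul]
      congr 1
      push_cast
      field_simp
    rw [div_pow, div_le_iff₀ (by positivity)] at h2
    rw [Nat.factorial_succ]
    push_cast
    have e : (n : ℝ) + 1 + 1 = n + 2 := by ring
    rw [e]
    calc ((n : ℝ) + 2) ^ (n + 1) ≤ Real.exp 1 * (n + 1) ^ (n + 1) := h2
      _ = (Real.exp 1 * (n + 1)) * (n + 1) ^ n := by ring
      _ ≤ (Real.exp 1 * (n + 1)) * (Real.exp 1 ^ n * (n.factorial : ℝ)) := by gcongr
      _ = _ := by ring

lemma aux_choose (d n : ℕ) :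
    ((d * (n + 1)).choose n : ℝ) ≤ (Real.exp 1 * d) ^ n := by
  have h := Nat.choose_le_pow_div (α := ℝ) n (d * (n + 1))
  refine h.trans ?_
  rw [div_le_iff₀ (by positivity)]
  push_cast
  rw [mul_pow, mul_pow]
  have := mul_le_mul_of_nonneg_left (aux_exp n) (show (0 : ℝ) ≤ (d : ℝ) ^ n by positivity)
  linarith

theorem stmt17 {V : Type*} [Fintype V] (G : SimpleGraph V) [DecidableRel G.Adj]
    (d k : ℕ) (hk : 1 ≤ k) (hdeg : ∀ v, G.degree v ≤ d) :
    (Nat.card {s : Finset V // s.card = k ∧ (G.induce (s : Set V)).Connected} : ℝ) ≤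
      (Fintype.card V) * (Real.exp 1 * d) ^ (k - 1) := by
  classical
  obtain ⟨n, rfl⟩ : ∃ n, k = n + 1 := ⟨k - 1, by omega⟩
  rw [Nat.add_sub_cancel]
  have hdeg' : ∀ v, (G.neighborFinset v).card ≤ d := fun v => hdeg v
  have key : Nat.card {s : Finset V // s.card = n + 1 ∧ (G.induce (s : Set V)).Connected} ≤
      Fintype.card V * (d * (n + 1)).choose n := by
    rw [Nat.card_eq_fintype_card, Fintype.card_subtype]
    refine le_trans (Finset.card_le_card (t := Finset.univ.biUnion fun v : V =>
      Finset.univ.filter fun S : Finset V => {v} ⊆ S ∧ Disjoint S ∅ ∧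
        S.card = ({v} : Finset V).card + n ∧ (G.induce (S : Set V)).Connected) ?_)
      (Finset.card_biUnion_le_card_mul _ _ _ ?_)
    · intro S hS
      simp only [Finset.mem_filter, Finset.mem_univ, true_and, Finset.mem_biUnion] at hS ⊢
      obtain ⟨v, hv⟩ := Finset.card_pos.1 (show 0 < S.card by omega)
      exact ⟨v, by simpa using hv, by simp, by simp; omega, hS.2⟩
    · intro v _
      convert aux_count G d (fun v => by convert hdeg' v) v (d * (n + 1)) n {v} ∅ (by simp)
        (by simp) (by simp; ring)
  calc _ ≤ ((Fintype.card V * (d * (n + 1)).choose n : ℕ) : ℝ) := by exact_mod_cast key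
    _ ≤ _ := by
      push_cast
      gcongr
      exact aux_choose d n
end

section
/- For every d ≥ 2 there exists a constant c < 2 such that for all d-regular graphs G on n vertices, N(G) ≤ c^n; moreover one can take c = (2^{d+1} − 1)^{1/(d+1)}. -/
open SimpleGraph

/-- The number of (nonempty) vertex subsets of `G` inducing a connected subgraph. -/
noncomputable def numConnSets {V : Type*} (G : SimpleGraph V) : ℕ :=
  Nat.card {s : Finset V // (G.induce (s : Set V)).Connected}

open scoped ENNReal

lemma holder2 {ι : Type*} (s : Finset ι) (a b : ι → ℝ≥0∞) (p : ℝ) (hp : 0 ≤ p)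
    (h : (s.card : ℝ) * p = 1) :
    ∏ i ∈ s, a i ^ p + ∏ i ∈ s, b i ^ p ≤ ∏ i ∈ s, (a i + b i) ^ p := by
  have := ENNReal.lintegral_prod_norm_pow_le (μ := MeasureTheory.Measure.count (α := Bool)) s
    (f := fun i x => if x then a i else b i) (fun i _ => (measurable_of_finite _).aemeasurable)
    (p := fun _ => p) (by simpa using h) (fun _ _ => hp)
  simpa [MeasureTheory.lintegral_count, tsum_fintype] using this

lemma shearer {V ι : Type*} [DecidableEq V] [Fintype ι] (k : ℕ) (hk : 0 < k)
    (A : ι → Finset V) (s : Finset V)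
    (h : ∀ a ∈ s, (Finset.univ.filter fun i => a ∈ A i).card = k) :
    ∀ F : ι → Finset V → ℝ≥0∞,
    ∑ S ∈ s.powerset, ∏ i, (F i (S ∩ A i)) ^ ((k : ℝ)⁻¹) ≤
      ∏ i, (∑ T ∈ (s ∩ A i).powerset, F i T) ^ ((k : ℝ)⁻¹) := by
  induction s using Finset.induction with
  | empty => intro F; simp
  | insert a s ha ih =>
    intro F
    have ih' := ih (fun b hb => h b (Finset.mem_insert_of_mem hb))
    set p : ℝ := (k : ℝ)⁻¹ with hp
    have hp0 : 0 ≤ p := by positivity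
    rw [Finset.sum_powerset_insert ha]
    let F1 : ι → Finset V → ℝ≥0∞ := fun i T => if a ∈ A i then F i (insert a T) else F i T
    have e1 : ∀ t, ∀ i, F i (insert a t ∩ A i) = F1 i (t ∩ A i) := by
      intro t i
      simp only [F1]
      split_ifs with hi
      · rw [Finset.insert_inter_of_mem hi]
      · rw [Finset.insert_inter_of_notMem hi]
    simp_rw [e1]
    refine (add_le_add (ih' F) (ih' F1)).trans ?_
    have key := holder2 (Finset.univ.filter fun i => a ∈ A i)
      (fun i => ∑ T ∈ (s ∩ A i).powerset, F i T) (fun i => ∑ T ∈ (s ∩ A i).powerset, F1 i T) p hp0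
      (by rw [h a (Finset.mem_insert_self a s), hp]; field_simp)
    rw [← Finset.prod_filter_mul_prod_filter_not Finset.univ (fun i => a ∈ A i),
      ← Finset.prod_filter_mul_prod_filter_not Finset.univ (fun i => a ∈ A i)
        (fun i => (∑ T ∈ (s ∩ A i).powerset, F1 i T) ^ p),
      ← Finset.prod_filter_mul_prod_filter_not Finset.univ (fun i => a ∈ A i)
        (fun i => (∑ T ∈ (insert a s ∩ A i).powerset, F i T) ^ p)]
    have e2 : ∏ i ∈ Finset.univ.filter (fun i => ¬ a ∈ A i), (∑ T ∈ (s ∩ A i).powerset, F1 i T) ^ p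
        = ∏ i ∈ Finset.univ.filter (fun i => ¬ a ∈ A i), (∑ T ∈ (s ∩ A i).powerset, F i T) ^ p := by
      refine Finset.prod_congr rfl fun i hi => ?_
      simp only [Finset.mem_filter] at hi
      simp [F1, hi.2]
    have e3 : ∏ i ∈ Finset.univ.filter (fun i => ¬ a ∈ A i),
          (∑ T ∈ (insert a s ∩ A i).powerset, F i T) ^ p
        = ∏ i ∈ Finset.univ.filter (fun i => ¬ a ∈ A i), (∑ T ∈ (s ∩ A i).powerset, F i T) ^ p := by
      refine Finset.prod_congr rfl fun i hi => ?_
      simp only [Finset.mem_filter] at hi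
      rw [Finset.insert_inter_of_notMem hi.2]
    have e4 : ∏ i ∈ Finset.univ.filter (fun i => a ∈ A i),
          (∑ T ∈ (insert a s ∩ A i).powerset, F i T) ^ p
        = ∏ i ∈ Finset.univ.filter (fun i => a ∈ A i),
          (∑ T ∈ (s ∩ A i).powerset, F i T + ∑ T ∈ (s ∩ A i).powerset, F1 i T) ^ p := by
      refine Finset.prod_congr rfl fun i hi => ?_
      simp only [Finset.mem_filter] at hi
      rw [Finset.insert_inter_of_mem hi.2, Finset.sum_powerset_insert (by simp [ha])]
      simp [F1, hi.2]
    rw [e2, e3, e4, ← add_mul]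
    gcongr

section graph
variable {V : Type} [Fintype V] [DecidableEq V] (G : SimpleGraph V) [DecidableRel G.Adj]

/-- Closed neighbourhood. -/
def cN (v : V) : Finset V := insert v (G.neighborFinset v)

lemma mem_cN (v w : V) : w ∈ cN G v ↔ w = v ∨ G.Adj v w := by simp [cN]

lemma mem_cN_comm (v w : V) : w ∈ cN G v ↔ v ∈ cN G w := by
  rw [mem_cN, mem_cN, G.adj_comm, eq_comm]

lemma card_cN {d : ℕ} (h : G.IsRegularOfDegree d) (v : V) : (cN G v).card = d + 1 := by
  rw [cN, Finset.card_insert_of_notMem (by simp), G.card_neighborFinset_eq_degree, h v]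

lemma iso_iff (S : Finset V) (v : V) :
    S ∩ cN G v = {v} ↔ v ∈ S ∧ ∀ w ∈ S, ¬ G.Adj v w := by
  constructor
  · intro h
    refine ⟨?_, fun w hw ha => ?_⟩
    · have : v ∈ S ∩ cN G v := by simp [h]
      exact (Finset.mem_inter.1 this).1
    · have : w ∈ S ∩ cN G v := Finset.mem_inter.2 ⟨hw, (mem_cN G v w).2 (Or.inr ha)⟩
      rw [h, Finset.mem_singleton] at this
      subst this
      exact G.loopless.irrefl _ ha
  · rintro ⟨h1, h2⟩
    ext w
    simp only [Finset.mem_inter, mem_cN, Finset.mem_singleton]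
    constructor
    · rintro ⟨hw, rfl | ha⟩
      · rfl
      · exact absurd ha (h2 w hw)
    · rintro rfl
      exact ⟨h1, Or.inl rfl⟩

/-- Sets without isolated vertices. -/
def noIso : Finset (Finset V) := Finset.univ.filter fun S => ∀ v, S ∩ cN G v ≠ {v}

/-- Sets with an isolated vertex. -/
def hasIso : Finset (Finset V) := Finset.univ.filter fun S => ∃ v, S ∩ cN G v = {v}

lemma card_noIso {d : ℕ} (h : G.IsRegularOfDegree d) :
    ((noIso G).card : ℝ) ≤ (((2 : ℝ) ^ (d + 1) - 1) ^ (((d : ℝ) + 1)⁻¹)) ^ (Fintype.card V) := by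
  have hs := shearer (d + 1) (Nat.succ_pos d) (cN G) Finset.univ (by
    intro a _
    rw [← card_cN G h a]
    congr 1
    ext i
    simp [mem_cN_comm G i a]) (fun v T => if T = {v} then 0 else 1)
  have hpos : (0:ℝ) < ((d + 1 : ℕ) : ℝ)⁻¹ := by positivity
  have h1 : ∑ S ∈ (Finset.univ : Finset V).powerset,
      ∏ i, ((if S ∩ cN G i = {i} then 0 else 1 : ℝ≥0∞)) ^ (((d + 1 : ℕ) : ℝ)⁻¹)
      = ((noIso G).card : ℝ≥0∞) := by
    rw [noIso, Finset.card_filter, Nat.cast_sum, Finset.powerset_univ]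
    refine Finset.sum_congr rfl fun S _ => ?_
    split_ifs with hS
    · rw [Finset.prod_eq_one]
      · simp
      · intro i _
        simp [hS i]
    · push Not at hS
      obtain ⟨v, hv⟩ := hS
      rw [Finset.prod_eq_zero (Finset.mem_univ v)]
      · simp
      · rw [if_pos hv, ENNReal.zero_rpow_of_pos hpos]
  have h2 : ∀ i, ∑ T ∈ (Finset.univ ∩ cN G i).powerset, (if T = {i} then 0 else 1 : ℝ≥0∞)
      = ((2 ^ (d + 1) - 1 : ℕ) : ℝ≥0∞) := by
    intro i
    rw [Finset.univ_inter]
    have : ((2 ^ (d + 1) - 1 : ℕ)) = ((cN G i).powerset.erase {i}).card := by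
      rw [Finset.card_erase_of_mem, Finset.card_powerset, card_cN G h]
      simp [mem_cN]
    rw [this, ← Finset.filter_ne', Finset.card_filter, Nat.cast_sum]
    refine Finset.sum_congr rfl fun S _ => ?_
    by_cases hS : S = {i} <;> simp [hS]
  simp only [h2] at hs
  rw [h1, Finset.prod_const, Finset.card_univ] at hs
  have h3 := ENNReal.toReal_mono (by
    apply ENNReal.pow_ne_top
    exact ENNReal.rpow_ne_top_of_nonneg hpos.le (ENNReal.natCast_ne_top _)) hs
  rw [ENNReal.toReal_natCast, ENNReal.toReal_pow, ← ENNReal.toReal_rpow,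
    ENNReal.toReal_natCast, Nat.cast_sub Nat.one_le_two_pow] at h3
  push_cast at h3
  exact h3

lemma conn_closed {S : Finset V} (hS : (G.induce (S : Set V)).Connected) (P : V → Prop)
    (hcl : ∀ a ∈ S, ∀ b ∈ S, G.Adj a b → P a → P b) {a b : V} (ha : a ∈ S) (hb : b ∈ S)
    (hP : P a) : P b := by
  obtain ⟨w⟩ := hS.preconnected ⟨a, ha⟩ ⟨b, hb⟩
  have : ∀ (x y : (S : Set V)), (G.induce (S : Set V)).Walk x y → P x → P y := by
    intro x y w
    induction w with
    | nil => exact id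
    | cons hadj _ ih => exact fun hx => ih (hcl _ (Subtype.mem _) _ (Subtype.mem _) hadj hx)
  exact this _ _ w hP

lemma conn_iso {S : Finset V} (hS : (G.induce (S : Set V)).Connected) {v : V}
    (hv : S ∩ cN G v = {v}) : S = {v} := by
  rw [iso_iff] at hv
  ext w
  rw [Finset.mem_singleton]
  constructor
  · intro hw
    refine conn_closed G hS (fun x => x = v) ?_ hv.1 hw rfl
    rintro a _ b hb hab rfl
    exact absurd hab (hv.2 b hb)
  · rintro rfl
    exact hv.1

open Classical in
/-- connected sets as a finset -/
noncomputable def connSets : Finset (Finset V) :=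
  Finset.univ.filter fun S => (G.induce (S : Set V)).Connected

lemma numConn_eq : numConnSets G = (connSets G).card := by
  classical
  rw [numConnSets, Nat.card_eq_fintype_card, Fintype.card_subtype, connSets]

lemma conn_inter_iso : (connSets G ∩ hasIso G).card ≤ Fintype.card V := by
  rw [← Finset.card_univ]
  refine (Finset.card_le_card (t := Finset.univ.image fun v : V => ({v} : Finset V)) ?_).trans
    Finset.card_image_le
  intro S hS
  simp only [connSets, hasIso, Finset.mem_inter, Finset.mem_filter, Finset.mem_univ, true_and] at hS
  obtain ⟨h1, v, hv⟩ := hS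
  simp [conn_iso G h1 hv]

lemma dense_count : (connSets G).card + (hasIso G).card + 1 ≤ 2 ^ Fintype.card V + Fintype.card V := by
  have h1 := Finset.card_union_add_card_inter (connSets G) (hasIso G)
  have h2 := conn_inter_iso G
  have h3 : (connSets G ∪ hasIso G).card + 1 ≤ 2 ^ Fintype.card V := by
    rw [← Fintype.card_finset, ← Finset.card_univ, ← Finset.card_erase_add_one (Finset.mem_univ ∅)]
    gcongr
    intro S hS
    simp only [Finset.mem_erase, Finset.mem_univ, and_true]
    rintro rfl
    simp only [connSets, hasIso, Finset.mem_union, Finset.mem_filter, Finset.mem_univ, true_and] at hS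
    rcases hS with hS | ⟨v, hv⟩
    · obtain ⟨x, hx⟩ := hS.nonempty
      simp at hx
    · rw [iso_iff] at hv
      simp at hv
  omega

lemma sparse_count (D : Finset (Finset V)) (hD : ∀ S ∈ D, S ∈ noIso G ∧ S ∉ connSets G)
    (hc : Fintype.card V ≤ D.card) : (connSets G).card ≤ (noIso G).card := by
  have h2 := conn_inter_iso G
  have h3 : (connSets G \ hasIso G).card + D.card ≤ (noIso G).card := by
    rw [← Finset.card_union_of_disjoint]
    · apply Finset.card_le_card
      intro S hS
      rcases Finset.mem_union.1 hS with hS | hS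
      · simp only [hasIso, noIso, Finset.mem_sdiff, Finset.mem_filter, Finset.mem_univ, true_and] at hS ⊢
        exact fun v hv => hS.2 ⟨v, hv⟩
      · exact (hD S hS).1
    · rw [Finset.disjoint_left]
      intro S hS hS'
      exact (hD S hS').2 (Finset.mem_sdiff.1 hS).1
  have := Finset.card_sdiff_add_card_inter (connSets G) (hasIso G)
  omega


/-- adjacent ordered pairs -/
def adjP : Finset (V × V) := Finset.univ.filter fun p => G.Adj p.1 p.2

lemma card_adjP {d : ℕ} (h : G.IsRegularOfDegree d) : (adjP G).card = Fintype.card V * d := by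
  have : adjP G = Finset.univ.biUnion fun u : V => (G.neighborFinset u).image fun v => (u, v) := by
    ext ⟨u, v⟩; simp [adjP]
  rw [adjP, Finset.card_filter, Fintype.sum_prod_type]
  simp_rw [← Finset.card_filter]
  rw [← Finset.card_univ, ← smul_eq_mul, ← Finset.sum_const]
  refine Finset.sum_congr rfl fun u _ => ?_
  rw [← h u, ← G.card_neighborFinset_eq_degree]
  congr 1
  ext v; simp

/-- pairs far from the neighbourhood of the edge `p` -/
def farP (p : V × V) : Finset (V × V) :=
  (adjP G).filter fun q => q.1 ∉ G.neighborFinset p.1 ∪ G.neighborFinset p.2 ∧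
    q.2 ∉ G.neighborFinset p.1 ∪ G.neighborFinset p.2

lemma card_touch {d : ℕ} (h : G.IsRegularOfDegree d) (A : Finset V) :
    ((adjP G).filter fun q => q.1 ∈ A ∨ q.2 ∈ A).card ≤ 2 * (A.card * d) := by
  have e1 : ((adjP G).filter fun q => q.1 ∈ A).card ≤ A.card * d := by
    refine (Finset.card_le_card (t := A.biUnion fun u => (G.neighborFinset u).image fun v => (u, v)) ?_).trans ?_
    · rintro ⟨x, y⟩ hq
      simp [adjP] at hq ⊢
      tauto
    · refine Finset.card_biUnion_le_card_mul _ _ _ fun u _ => ?_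
      refine Finset.card_image_le.trans ?_
      rw [G.card_neighborFinset_eq_degree, h u]
  have e2 : ((adjP G).filter fun q => q.2 ∈ A).card ≤ A.card * d := by
    refine (Finset.card_le_card (t := A.biUnion fun u => (G.neighborFinset u).image fun v => (v, u)) ?_).trans ?_
    · rintro ⟨x, y⟩ hq
      simp [adjP] at hq ⊢
      exact ⟨hq.2, hq.1.symm⟩
    · refine Finset.card_biUnion_le_card_mul _ _ _ fun u _ => ?_
      refine Finset.card_image_le.trans ?_
      rw [G.card_neighborFinset_eq_degree, h u]
  rw [Finset.filter_or]
  refine (Finset.card_union_le _ _).trans ?_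
  omega

lemma card_farP {d : ℕ} (h : G.IsRegularOfDegree d) (p : V × V) :
    Fintype.card V * d ≤ (farP G p).card + 4 * d ^ 2 := by
  have h1 := card_touch G h (G.neighborFinset p.1 ∪ G.neighborFinset p.2)
  have h2 := Finset.card_union_le (G.neighborFinset p.1) (G.neighborFinset p.2)
  rw [G.card_neighborFinset_eq_degree, G.card_neighborFinset_eq_degree, h, h] at h2
  have h3 := Finset.card_filter_add_card_filter_not (s := adjP G) (fun q => q.1 ∈ G.neighborFinset p.1 ∪ G.neighborFinset p.2 ∨ q.2 ∈ G.neighborFinset p.1 ∪ G.neighborFinset p.2)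
  rw [card_adjP G h] at h3
  have h4 : ((adjP G).filter fun q => ¬ (q.1 ∈ G.neighborFinset p.1 ∪ G.neighborFinset p.2 ∨ q.2 ∈ G.neighborFinset p.1 ∪ G.neighborFinset p.2)) = farP G p := by
    unfold farP
    congr 1
    ext q
    tauto
  rw [h4] at h3
  nlinarith

/-- pairs of far edges -/
def quads : Finset ((V × V) × (V × V)) :=
  (adjP G).biUnion fun p => (farP G p).image fun q => (p, q)

lemma mem_quads (u v x y : V) : ((u, v), (x, y)) ∈ quads G ↔ G.Adj u v ∧ G.Adj x y ∧
    ¬ G.Adj u x ∧ ¬ G.Adj v x ∧ ¬ G.Adj u y ∧ ¬ G.Adj v y := by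
  simp [quads, adjP, farP]
  tauto

lemma card_quads {d : ℕ} (hd : 2 ≤ d) (h : G.IsRegularOfDegree d) (hn : 6 * d ≤ Fintype.card V) :
    16 * Fintype.card V ≤ (quads G).card := by
  rw [quads, Finset.card_biUnion]
  · have : ∀ p ∈ adjP G, 8 ≤ ((farP G p).image fun q => (p, q)).card := by
      intro p _
      rw [Finset.card_image_of_injective _ (fun a b hab => by simpa using hab)]
      have := card_farP G h p
      nlinarith
    have h2 := Finset.card_nsmul_le_sum _ _ _ this
    rw [card_adjP G h, smul_eq_mul] at h2
    nlinarith
  · intro p _ p' _ hpp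
    rw [Function.onFun, Finset.disjoint_left]
    rintro ⟨a, b⟩ h1 h2
    simp at h1 h2
    exact hpp (h1.2.trans h2.2.symm)

/-- vertex set of a quad -/
def qset (q : (V × V) × (V × V)) : Finset V := {q.1.1, q.1.2, q.2.1, q.2.2}

lemma sparse {d : ℕ} (hd : 2 ≤ d) (h : G.IsRegularOfDegree d) (hn : 6 * d ≤ Fintype.card V) :
    (connSets G).card ≤ (noIso G).card := by
  apply sparse_count G ((quads G).image qset)
  · intro S hS
    rw [Finset.mem_image] at hS
    obtain ⟨⟨⟨u, v⟩, ⟨x, y⟩⟩, hq, rfl⟩ := hS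
    rw [mem_quads] at hq
    obtain ⟨huv, hxy, hux, hvx, huy, hvy⟩ := hq
    constructor
    · simp only [noIso, Finset.mem_filter, Finset.mem_univ, true_and]
      intro w hw
      rw [iso_iff] at hw
      obtain ⟨h1, h2⟩ := hw
      simp only [qset, Finset.mem_insert, Finset.mem_singleton] at h1 h2
      rcases h1 with rfl | rfl | rfl | rfl
      · exact h2 v (by simp) huv
      · exact h2 u (by simp) huv.symm
      · exact h2 y (by simp) hxy
      · exact h2 x (by simp) hxy.symm
    · intro hc
      simp only [connSets, Finset.mem_filter, Finset.mem_univ, true_and] at hc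
      have := conn_closed G hc (fun z => z = u ∨ z = v) (by
        intro a _ b hb hab ha
        simp only [qset, Finset.mem_insert, Finset.mem_singleton] at hb
        rcases ha with rfl | rfl <;> rcases hb with rfl | rfl | rfl | rfl <;> simp_all)
        (a := u) (b := x) (by simp [qset]) (by simp [qset]) (Or.inl rfl)
      rcases this with rfl | rfl
      · exact hvx huv.symm
      · exact hux huv
  · have h1 := Finset.card_le_mul_card_image (f := qset) (quads G) 16 (by
      intro S hS
      have hS4 : S.card ≤ 4 := by
        rw [Finset.mem_image] at hS
        obtain ⟨q, _, rfl⟩ := hS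
        exact Finset.card_le_four
      have : ((quads G).filter fun q => qset q = S).card ≤ (S ×ˢ S).card := by
        apply Finset.card_le_card_of_injOn (fun q => (q.1.1, q.2.1))
        · rintro ⟨⟨u, v⟩, ⟨x, y⟩⟩ hq
          simp only [Finset.coe_filter, Set.mem_ofPred_eq] at hq
          obtain ⟨_, rfl⟩ := hq
          simp [qset]
        · rintro ⟨⟨u, v⟩, ⟨x, y⟩⟩ hq ⟨⟨u', v'⟩, ⟨x', y'⟩⟩ hq' he
          simp only [Prod.mk.injEq] at he
          obtain ⟨rfl, rfl⟩ := he
          simp only [Finset.coe_filter, Set.mem_ofPred_eq, mem_quads] at hq hq'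
          obtain ⟨⟨huv, hxy, hux, hvx, huy, hvy⟩, e⟩ := hq
          obtain ⟨⟨huv', hxy', hux', hvx', huy', hvy'⟩, e'⟩ := hq'
          have hv : v ∈ qset ((u, v'), (x, y')) := by rw [e', ← e]; simp [qset]
          have hy : y ∈ qset ((u, v'), (x, y')) := by rw [e', ← e]; simp [qset]
          simp only [qset, Finset.mem_insert, Finset.mem_singleton] at hv hy
          have hv2 : v = v' := by
            rcases hv with rfl | rfl | rfl | rfl
            · exact absurd huv (G.loopless.irrefl _)
            · rfl
            · exact absurd huv hux
            · exact absurd huv huy'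
          have hy2 : y = y' := by
            rcases hy with rfl | rfl | rfl | rfl
            · exact absurd hxy.symm hux
            · exact absurd hxy.symm hvx'
            · exact absurd hxy (G.loopless.irrefl _)
            · rfl
          rw [hv2, hy2]
      rw [Finset.card_product] at this
      nlinarith)
    have h2 := card_quads G hd h hn
    omega

lemma card_fix (A B : Finset V) (hB : B ⊆ A) :
    (Finset.univ.filter fun S : Finset V => S ∩ A = B).card = 2 ^ (Fintype.card V - A.card) := by
  rw [← Finset.card_compl, ← Finset.card_powerset]
  symm
  refine Finset.card_bij' (fun T _ => T ∪ B) (fun S _ => S \ A) ?_ ?_ ?_ ?_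
  · intro T hT
    rw [Finset.mem_powerset] at hT
    simp only [Finset.mem_filter, Finset.mem_univ, true_and]
    ext x
    have h1 := @hT x
    have h2 := @hB x
    simp at h1 ⊢
    tauto
  · intro S hS
    rw [Finset.mem_powerset]
    intro x
    simp
  · intro T hT
    rw [Finset.mem_powerset] at hT
    ext x
    have h1 := @hT x
    have h2 := @hB x
    simp at h1 ⊢
    tauto
  · intro S hS
    simp only [Finset.mem_filter, Finset.mem_univ, true_and] at hS
    ext x
    subst hS
    simp
    tauto

/-- number of isolated vertices -/
def isoV (S : Finset V) : Finset V := Finset.univ.filter fun v => S ∩ cN G v = {v}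

lemma sum_iso {d : ℕ} (h : G.IsRegularOfDegree d) :
    ∑ S ∈ hasIso G, ((isoV G S).card : ℝ) =
      (Fintype.card V : ℝ) * 2 ^ (Fintype.card V - (d + 1)) := by
  have h1 : ∑ S ∈ hasIso G, (isoV G S).card = ∑ S : Finset V, (isoV G S).card := by
    apply Finset.sum_subset (Finset.subset_univ _)
    intro S _ hS
    simp [hasIso] at hS
    simp [isoV, hS]
  have h2 : ∑ S : Finset V, (isoV G S).card = Fintype.card V * 2 ^ (Fintype.card V - (d + 1)) := by
    simp_rw [isoV, Finset.card_filter]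
    rw [Finset.sum_comm]
    simp_rw [← Finset.card_filter]
    rw [← Finset.card_univ (α := V), ← smul_eq_mul, ← Finset.sum_const]
    refine Finset.sum_congr rfl fun v _ => ?_
    rw [card_fix _ _ (by simp [mem_cN]), card_cN G h, Finset.card_univ]
  rw [← h1] at h2
  exact_mod_cast h2

lemma sum_iso_sq :
    ∑ S ∈ hasIso G, ((isoV G S).card : ℝ) ^ 2 =
      ∑ v, ∑ w, (((Finset.univ.filter fun S : Finset V =>
        S ∩ cN G v = {v} ∧ S ∩ cN G w = {w}).card : ℕ) : ℝ) := by
  have h1 : ∑ S ∈ hasIso G, (isoV G S).card ^ 2 = ∑ S : Finset V, (isoV G S).card ^ 2 := by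
    apply Finset.sum_subset (Finset.subset_univ _)
    intro S _ hS
    simp [hasIso] at hS
    simp [isoV, hS]
  have h2 : ∑ S : Finset V, (isoV G S).card ^ 2 = ∑ v, ∑ w, ((Finset.univ.filter fun S : Finset V =>
        S ∩ cN G v = {v} ∧ S ∩ cN G w = {w}).card) := by
    simp_rw [isoV, sq, Finset.card_filter, Finset.sum_mul_sum]
    rw [Finset.sum_comm]
    refine Finset.sum_congr rfl fun v _ => ?_
    rw [Finset.sum_comm]
    refine Finset.sum_congr rfl fun w _ => ?_
    refine Finset.sum_congr rfl fun S _ => ?_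
    split_ifs <;> simp_all
  rw [← h1] at h2
  exact_mod_cast h2

/-- common neighbours -/
def cm (v w : V) : ℕ := (G.neighborFinset v ∩ G.neighborFinset w).card

lemma pair_eq {d : ℕ} (h : G.IsRegularOfDegree d) (v w : V) (hw : w ∉ cN G v) :
    ((Finset.univ.filter fun S : Finset V =>
        S ∩ cN G v = {v} ∧ S ∩ cN G w = {w}).card : ℝ) * 2 ^ (d + 1)
      = 2 ^ (Fintype.card V - (d + 1)) * 2 ^ (cm G v w) := by
  have hu : (cN G v ∪ cN G w).card + cm G v w = 2 * (d + 1) := by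
    have h1 := Finset.card_union_add_card_inter (cN G v) (cN G w)
    rw [card_cN G h, card_cN G h] at h1
    have : cN G v ∩ cN G w = G.neighborFinset v ∩ G.neighborFinset w := by
      ext x
      rw [mem_cN] at hw
      simp only [Finset.mem_inter, mem_cN, mem_neighborFinset]
      constructor
      · rintro ⟨rfl | h1, rfl | h2⟩
        · tauto
        · exact absurd (Or.inr h2.symm) hw
        · tauto
        · tauto
      · tauto
    rw [this] at h1
    unfold cm; omega
  have hle : (cN G v ∪ cN G w).card ≤ Fintype.card V := Finset.card_le_univ _
  have hle2 : d + 1 ≤ Fintype.card V := by rw [← card_cN G h v]; exact Finset.card_le_univ _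
  have hf := card_fix (cN G v ∪ cN G w) {v, w} (by
    intro x hx
    simp at hx
    simp [mem_cN]
    tauto)
  have heq : (Finset.univ.filter fun S : Finset V => S ∩ cN G v = {v} ∧ S ∩ cN G w = {w})
      = Finset.univ.filter fun S : Finset V => S ∩ (cN G v ∪ cN G w) = {v, w} := by
    ext S
    simp only [Finset.mem_filter, Finset.mem_univ, true_and]
    constructor
    · rintro ⟨h1, h2⟩
      rw [Finset.inter_union_distrib_left, h1, h2]
      rfl
    · intro hS
      have hv : v ∉ cN G w := by rwa [mem_cN_comm]
      have hv' : v ∈ cN G v := by simp [mem_cN]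
      have hw' : w ∈ cN G w := by simp [mem_cN]
      constructor
      · ext x
        have := Finset.ext_iff.1 hS x
        simp at this ⊢
        constructor
        · rintro ⟨a, b⟩
          rcases this.1 ⟨a, Or.inl b⟩ with rfl | rfl
          · rfl
          · exact absurd b hw
        · rintro rfl
          exact ⟨(this.2 (Or.inl rfl)).1, hv'⟩
      · ext x
        have := Finset.ext_iff.1 hS x
        simp at this ⊢
        constructor
        · rintro ⟨a, b⟩
          rcases this.1 ⟨a, Or.inr b⟩ with rfl | rfl
          · exact absurd b hv
          · rfl
        · rintro rfl
          exact ⟨(this.2 (Or.inr rfl)).1, hw'⟩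
  rw [heq, hf]
  push_cast
  rw [← pow_add, ← pow_add]
  congr 1
  omega

lemma cm_le {d : ℕ} (h : G.IsRegularOfDegree d) (v w : V) : cm G v w ≤ d := by
  rw [← h v, ← G.card_neighborFinset_eq_degree]
  exact Finset.card_le_card Finset.inter_subset_left

lemma sum_cm {d : ℕ} (h : G.IsRegularOfDegree d) (v : V) :
    ∑ w ∈ (cN G v)ᶜ, cm G v w ≤ d * (d - 1) := by
  have h1 : ∀ w, cm G v w = ∑ x ∈ G.neighborFinset v, if G.Adj x w then 1 else 0 := by
    intro w
    rw [← Finset.card_filter, cm]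
    congr 1
    ext x
    simp [G.adj_comm w x]
  simp_rw [h1]
  rw [Finset.sum_comm]
  have h2 : ∀ x ∈ G.neighborFinset v, (∑ w ∈ (cN G v)ᶜ, if G.Adj x w then 1 else 0) ≤ d - 1 := by
    intro x hx
    rw [← Finset.card_filter, ← h x, ← G.card_neighborFinset_eq_degree,
      ← Finset.card_erase_of_mem (a := v) (by simpa using ((G.mem_neighborFinset v x).1 hx).symm)]
    apply Finset.card_le_card
    intro w hw
    simp [mem_cN] at hw ⊢
    tauto
  refine (Finset.sum_le_card_nsmul _ _ _ h2).trans ?_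
  rw [G.card_neighborFinset_eq_degree, h v, smul_eq_mul]

lemma chord (d y : ℕ) (hy : y ≤ d) (hd : 0 < d) : (2 : ℝ) ^ y ≤ 1 + y * ((2 ^ d - 1) / d) := by
  have key : ∀ e : ℕ, ∀ y ≤ e, (e : ℝ) * 2 ^ y ≤ e + y * (2 ^ e - 1) := by
    intro e
    induction e with
    | zero => intro y hy; simp at hy; subst hy; simp
    | succ e ih =>
      intro y hy
      rcases Nat.lt_or_ge e y with h | h
      · have : y = e + 1 := by omega
        subst this
        apply le_of_eq; ring
      · have h1 := ih y h
        have h2 : (2:ℝ) ^ y ≤ 1 + y * 2 ^ e := by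
          rcases Nat.eq_zero_or_pos y with rfl | hy0
          · simp
          · have a : (2:ℝ) ^ y ≤ 2 ^ e := pow_le_pow_right₀ (by norm_num) h
            have b : (1:ℝ) ≤ y := by exact_mod_cast hy0
            nlinarith [pow_pos (two_pos (α := ℝ)) e]
        push_cast
        rw [pow_succ]
        nlinarith
  have := key d y hy
  have hd' : (0:ℝ) < d := by exact_mod_cast hd
  rw [mul_div_assoc', ← sub_le_iff_le_add', le_div_iff₀ hd']
  linarith

lemma row_bound {d : ℕ} (hd : 2 ≤ d) (h : G.IsRegularOfDegree d) (m : ℕ)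
    (hm : Fintype.card V = m + d + 1) (v : V) (E : ℝ)
    (hE : E = 1 + m / 2 ∨ E = (d + 1) / 2 + (m - d + 1) / 2 ^ (d + 1)) :
    ∑ w, (((Finset.univ.filter fun S : Finset V =>
        S ∩ cN G v = {v} ∧ S ∩ cN G w = {w}).card : ℕ) : ℝ) ≤ 2 ^ m * E := by
  have hnm : Fintype.card V - (d + 1) = m := by omega
  have hcc : ((cN G v)ᶜ).card = m := by rw [Finset.card_compl, card_cN G h, hnm]
  rw [← Finset.sum_add_sum_compl (cN G v)]
  have h1 : ∑ w ∈ cN G v, (((Finset.univ.filter fun S : Finset V =>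
        S ∩ cN G v = {v} ∧ S ∩ cN G w = {w}).card : ℕ) : ℝ) = 2 ^ m := by
    rw [Finset.sum_eq_single v]
    · simp only [and_self]
      rw [card_fix _ _ (by simp [mem_cN]), card_cN G h, hnm]
      simp
    · intro w hw hwv
      rw [mem_cN] at hw
      rw [Nat.cast_eq_zero, Finset.card_eq_zero, Finset.filter_eq_empty_iff]
      rintro S _ ⟨a, b⟩
      rw [iso_iff] at a b
      exact a.2 w b.1 (hw.resolve_left hwv)
    · intro hv
      simp [mem_cN] at hv
  have h2 : ∑ w ∈ (cN G v)ᶜ, (((Finset.univ.filter fun S : Finset V =>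
        S ∩ cN G v = {v} ∧ S ∩ cN G w = {w}).card : ℕ) : ℝ)
      = 2 ^ m / 2 ^ (d + 1) * ∑ w ∈ (cN G v)ᶜ, (2 : ℝ) ^ (cm G v w) := by
    rw [Finset.mul_sum]
    refine Finset.sum_congr rfl fun w hw => ?_
    have := pair_eq G h v w (Finset.mem_compl.1 hw)
    rw [hnm] at this
    field_simp
    linarith
  rw [h1, h2]
  have hp : (0:ℝ) < 2 ^ m := by positivity
  have hp' : (0:ℝ) < 2 ^ (d + 1) := by positivity
  have hgoal : 1 + (∑ w ∈ (cN G v)ᶜ, (2 : ℝ) ^ (cm G v w)) / 2 ^ (d + 1) ≤ E := by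
    rcases hE with rfl | rfl
    · have : ∑ w ∈ (cN G v)ᶜ, (2 : ℝ) ^ (cm G v w) ≤ m * 2 ^ d := by
        rw [← hcc, ← nsmul_eq_mul]
        refine Finset.sum_le_card_nsmul _ _ _ fun w _ => ?_
        exact pow_le_pow_right₀ (by norm_num) (cm_le G h v w)
      have h3 : (∑ w ∈ (cN G v)ᶜ, (2 : ℝ) ^ (cm G v w)) / 2 ^ (d + 1) ≤ m / 2 := by
        rw [div_le_iff₀ hp', pow_succ]
        linarith
      linarith
    · have hs : (∑ w ∈ (cN G v)ᶜ, (cm G v w : ℝ)) ≤ d * (d - 1) := by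
        have := sum_cm G h v
        have e : ((d * (d - 1) : ℕ) : ℝ) = d * (d - 1) := by
          rw [Nat.cast_mul, Nat.cast_sub (by omega)]; simp
        rw [← e]
        exact_mod_cast this
      have hd0 : (0:ℝ) < d := by positivity
      have : ∑ w ∈ (cN G v)ᶜ, (2 : ℝ) ^ (cm G v w) ≤ m + (d - 1) * (2 ^ d - 1) := by
        calc _ ≤ ∑ w ∈ (cN G v)ᶜ, (1 + (cm G v w : ℝ) * ((2 ^ d - 1) / d)) :=
              Finset.sum_le_sum fun w _ => chord d _ (cm_le G h v w) (by omega)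
          _ = m + (∑ w ∈ (cN G v)ᶜ, (cm G v w : ℝ)) * ((2 ^ d - 1) / d) := by
              rw [Finset.sum_add_distrib, Finset.sum_const, hcc, Finset.sum_mul]; simp
          _ ≤ m + (d * (d - 1)) * ((2 ^ d - 1) / d) := by
              have : (1:ℝ) ≤ 2 ^ d := one_le_pow₀ (by norm_num)
              have : (0:ℝ) ≤ (2 ^ d - 1) / d := div_nonneg (by linarith) hd0.le
              gcongr
          _ = _ := by field_simp
      have h3 : (∑ w ∈ (cN G v)ᶜ, (2 : ℝ) ^ (cm G v w)) / 2 ^ (d + 1)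
          ≤ (m + (d - 1) * (2 ^ d - 1)) / 2 ^ (d + 1) := by gcongr
      have h4 : (m + (d - 1) * (2 ^ d - 1)) / 2 ^ (d + 1) = ((d:ℝ) - 1) / 2 + (m - d + 1) / 2 ^ (d + 1) := by
        rw [pow_succ]
        field_simp
        ring
      linarith
  calc _ = 2 ^ m * (1 + (∑ w ∈ (cN G v)ᶜ, (2 : ℝ) ^ (cm G v w)) / 2 ^ (d + 1)) := by ring
    _ ≤ _ := by gcongr

lemma hasIso_bound {d : ℕ} (hd : 2 ≤ d) (h : G.IsRegularOfDegree d) (m : ℕ)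
    (hm : Fintype.card V = m + d + 1) (E : ℝ)
    (hE : E = 1 + m / 2 ∨ E = (d + 1) / 2 + (m - d + 1) / 2 ^ (d + 1)) :
    ((m : ℝ) + d + 1) * 2 ^ m ≤ (hasIso G).card * E := by
  have hnm : Fintype.card V - (d + 1) = m := by omega
  have h1 := sum_iso G h
  have h2 : ∑ S ∈ hasIso G, ((isoV G S).card : ℝ) ^ 2 ≤ (Fintype.card V : ℝ) * (2 ^ m * E) := by
    rw [sum_iso_sq, ← nsmul_eq_mul]
    exact Finset.sum_le_card_nsmul _ _ _ fun v _ => row_bound G hd h m hm v E hE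
  have h3 := sq_sum_le_card_mul_sum_sq (s := hasIso G) (f := fun S => ((isoV G S).card : ℝ))
  rw [h1, hnm] at h3
  have hn : (Fintype.card V : ℝ) = m + d + 1 := by rw [hm]; push_cast; ring
  rw [hn] at h2 h3
  have hP : (0:ℝ) < ((m : ℝ) + d + 1) * 2 ^ m := by positivity
  have h4 : (((m : ℝ) + d + 1) * 2 ^ m) ^ 2 ≤ (hasIso G).card * (((m : ℝ) + d + 1) * (2 ^ m * E)) :=
    h3.trans (mul_le_mul_of_nonneg_left h2 (Nat.cast_nonneg _))
  have h5 : (((m : ℝ) + d + 1) * 2 ^ m) * (((m : ℝ) + d + 1) * 2 ^ m)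
      ≤ (((m : ℝ) + d + 1) * 2 ^ m) * ((hasIso G).card * E) := by nlinarith
  exact le_of_mul_le_mul_left h5 hP

end graph
lemma four_mul_le (d : ℕ) (hd : 4 ≤ d) : 4 * d ≤ 2 ^ d := by
  induction d, hd using Nat.le_induction with
  | base => norm_num
  | succ k hk ih => rw [pow_succ]; omega

lemma five_pow (m : ℕ) (hm : 3 ≤ m) : 8 * (m + 2) ≤ 5 * 2 ^ m := by
  induction m, hm using Nat.le_induction with
  | base => norm_num
  | succ k hk ih => rw [pow_succ]; omega

lemma numeric (d m U : ℕ) (hd : 2 ≤ d) (hm : m + 2 ≤ 5 * d)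
    (h1 : ((m : ℝ) + d + 1) * 2 ^ m ≤ U * (1 + m / 2))
    (h2 : ((m : ℝ) + d + 1) * 2 ^ m ≤ U * ((d + 1) / 2 + (m - d + 1) / 2 ^ (d + 1))) :
    (m : ℝ) + d + ((m : ℝ) + d + 1) * 2 ^ m / (d + 1) ≤ U := by
  rcases Nat.lt_or_ge d 4 with hd4 | hd4
  · have : d = 2 ∨ d = 3 := by omega
    rcases this with rfl | rfl
    · by_cases hm1 : m = 1
      · subst hm1
        norm_num at h1
        have : 5 < U := by
          by_contra hU
          have : (U : ℝ) ≤ 5 := by exact_mod_cast (by omega : U ≤ 5)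
          linarith
        have : (6 : ℝ) ≤ U := by exact_mod_cast this
        norm_num
        linarith
      · have : m ≤ 8 := by omega
        generalize (U : ℝ) = u at *
        interval_cases m <;> first | exact absurd rfl hm1 | (norm_num at h1 h2 ⊢; linarith)
    · have : m ≤ 13 := by omega
      generalize (U : ℝ) = u at *
      interval_cases m <;> norm_num at h1 h2 ⊢ <;> linarith
  · have hdr : (4 : ℝ) ≤ d := by exact_mod_cast hd4
    have hU : (0:ℝ) ≤ U := by positivity
    have hX : (0:ℝ) < 2 ^ m := by positivity
    rcases Nat.lt_or_ge m 3 with hm3 | hm3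
    · rw [← le_sub_iff_add_le', div_le_iff₀ (by linarith)]
      interval_cases m <;> norm_num at h1 ⊢ <;> nlinarith
    · have suff : ((m : ℝ) + d + 1) * (1 + 2 ^ m / (d + 1)) ≤ U →
          (m : ℝ) + d + ((m : ℝ) + d + 1) * 2 ^ m / (d + 1) ≤ U := by
        intro h
        rw [mul_add, mul_one, ← mul_div_assoc] at h
        linarith
      apply suff
      have hn : (0:ℝ) < (m : ℝ) + d + 1 := by positivity
      rcases Nat.lt_or_ge d m with hmd | hmd
      · have e1 : ((m : ℝ) - d + 1) / 2 ^ (d + 1) ≤ 1 / 2 := by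
          rw [div_le_iff₀ (by positivity), pow_succ]
          have a : ((4 * d : ℕ) : ℝ) ≤ ((2 ^ d : ℕ) : ℝ) := by exact_mod_cast four_mul_le d hd4
          have b : ((m + 2 : ℕ) : ℝ) ≤ ((5 * d : ℕ) : ℝ) := by exact_mod_cast hm
          push_cast at a b
          linarith
        have e2 : ((m : ℝ) + d + 1) * 2 ^ m ≤ U * ((d + 2) / 2) :=
          h2.trans (mul_le_mul_of_nonneg_left (by linarith) hU)
        have e3 : ((4 * d : ℕ) : ℝ) ≤ 2 ^ m := by
          have := (four_mul_le d hd4).trans (Nat.pow_le_pow_right (n := 2) (by norm_num) hmd.le)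
          exact_mod_cast this
        push_cast at e3
        have e4 : (1 + (2:ℝ) ^ m / (d + 1)) ≤ 2 ^ m * (2 / (d + 2)) := by
          have : (2:ℝ) ^ m * (2 / (d + 2)) - (1 + (2:ℝ) ^ m / (d + 1))
            = (2 ^ m * d - (d + 1) * (d + 2)) / ((d + 1) * (d + 2)) := by
            field_simp; ring
          have : 0 ≤ (2 ^ m * (d:ℝ) - (d + 1) * (d + 2)) / ((d + 1) * (d + 2)) := by
            apply div_nonneg _ (by positivity)
            nlinarith
          linarith
        calc _ ≤ ((m : ℝ) + d + 1) * (2 ^ m * (2 / (d + 2))) := by gcongr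
          _ = (((m : ℝ) + d + 1) * 2 ^ m) * (2 / (d + 2)) := by ring
          _ ≤ (U * ((d + 2) / 2)) * (2 / (d + 2)) := by gcongr
          _ = U := by field_simp
      · have hmd' : (m : ℝ) ≤ d := by exact_mod_cast hmd
        have e3 : ((8 * (m + 2) : ℕ) : ℝ) ≤ ((5 * 2 ^ m : ℕ) : ℝ) := by
          exact_mod_cast five_pow m hm3
        push_cast at e3
        have e4 : (1 + (2:ℝ) ^ m / (d + 1)) ≤ 2 ^ m * (2 / (m + 2)) := by
          have : (2:ℝ) ^ m * (2 / (m + 2)) - (1 + (2:ℝ) ^ m / (d + 1))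
            = (2 ^ m * (2 * d - m) - (d + 1) * (m + 2)) / ((d + 1) * (m + 2)) := by
            field_simp; ring
          have : 0 ≤ (2 ^ m * (2 * (d:ℝ) - m) - (d + 1) * (m + 2)) / ((d + 1) * (m + 2)) := by
            apply div_nonneg _ (by positivity)
            have f1 : (2:ℝ) ^ m * d ≤ 2 ^ m * (2 * (d:ℝ) - m) := by gcongr; linarith
            have f2 : 8 / 5 * ((m:ℝ) + 2) * d ≤ 2 ^ m * d := by gcongr; linarith
            have f3 : ((m:ℝ) + 2) * (d + 1) ≤ ((m:ℝ) + 2) * (8 / 5 * d) := by gcongr; linarith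
            linarith
          linarith
        calc _ ≤ ((m : ℝ) + d + 1) * (2 ^ m * (2 / (m + 2))) := by gcongr
          _ = (((m : ℝ) + d + 1) * 2 ^ m) * (2 / (m + 2)) := by ring
          _ ≤ (U * (1 + m / 2)) * (2 / (m + 2)) := by gcongr
          _ = U := by field_simp; ring

lemma bern (d m : ℕ) : (2:ℝ) ^ (m + d + 1) - ((m : ℝ) + d + 1) * 2 ^ m / (d + 1)
    ≤ (((2 : ℝ) ^ (d + 1) - 1) ^ (((d : ℝ) + 1)⁻¹)) ^ (m + d + 1) := by
  have hk : (1:ℝ) ≤ 2 ^ (d + 1) := one_le_pow₀ (by norm_num)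
  have hx : ((2:ℝ) ^ (d + 1))⁻¹ ≤ 1 := inv_le_one_of_one_le₀ hk
  have hd : (0:ℝ) < d + 1 := by positivity
  have h := one_add_mul_self_le_rpow_one_add (s := -((2:ℝ) ^ (d + 1))⁻¹) (by linarith)
    (p := ((m + d + 1 : ℕ) : ℝ) * ((d : ℝ) + 1)⁻¹) (by
      rw [← div_eq_mul_inv, one_le_div hd]; push_cast; linarith [Nat.cast_nonneg (α := ℝ) m])
  have e1 : (2 : ℝ) ^ (d + 1) - 1 = 2 ^ (d + 1) * (1 + -((2:ℝ) ^ (d + 1))⁻¹) := by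
    field_simp; ring
  have e2 : ((2:ℝ) ^ (d + 1)) ^ (((d : ℝ) + 1)⁻¹) = 2 := by
    have := Real.pow_rpow_inv_natCast (x := 2) (n := d + 1) (by norm_num) (by omega)
    push_cast at this
    exact this
  rw [e1, Real.mul_rpow (by positivity) (by linarith), e2, mul_pow, ← Real.rpow_mul_natCast (by linarith),
    mul_comm (((d : ℝ) + 1)⁻¹)]
  calc _ = (2:ℝ) ^ (m + d + 1) * (1 + ((m + d + 1 : ℕ) : ℝ) * ((d : ℝ) + 1)⁻¹ * -((2:ℝ) ^ (d + 1))⁻¹) := by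
        push_cast
        rw [add_assoc m d 1, pow_add]
        field_simp
        ring
    _ ≤ _ := by gcongr

theorem stmt19 (d : ℕ) (hd : 2 ≤ d) :
    ∃ c : ℝ, c < 2 ∧ c = ((2 : ℝ) ^ (d + 1) - 1) ^ (((d : ℝ) + 1)⁻¹) ∧
      ∀ (V : Type) [Fintype V] (G : SimpleGraph V) [DecidableRel G.Adj],
        G.IsRegularOfDegree d → (numConnSets G : ℝ) ≤ c ^ (Fintype.card V) := by
  refine ⟨_, ?_, rfl, ?_⟩
  · have e2 : ((2:ℝ) ^ (d + 1)) ^ (((d : ℝ) + 1)⁻¹) = 2 := by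
      have := Real.pow_rpow_inv_natCast (x := 2) (n := d + 1) (by norm_num) (by omega)
      push_cast at this
      exact this
    have hk : (1:ℝ) ≤ 2 ^ (d + 1) := one_le_pow₀ (by norm_num)
    conv_rhs => rw [← e2]
    exact Real.rpow_lt_rpow (by linarith) (by linarith) (by positivity)
  · intro V _ G _ h
    classical
    rw [numConn_eq]
    rcases Nat.lt_or_ge (Fintype.card V) (6 * d) with hn | hn
    · have hdc := dense_count G
      rcases isEmpty_or_nonempty V with hV | ⟨⟨v⟩⟩
      · have h0 : Fintype.card V = 0 := Fintype.card_eq_zero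
        rw [h0, pow_zero] at hdc
        rw [h0, pow_zero]
        have aux : ∀ x y : ℕ, x + y + 1 ≤ 1 + 0 → (x : ℝ) ≤ 1 := by
          intro x y hxy
          exact_mod_cast (by omega : x ≤ 1)
        exact aux _ _ hdc
      · have hle : d + 1 ≤ Fintype.card V := by
          rw [← card_cN G h v]; exact Finset.card_le_univ _
        obtain ⟨m, hm⟩ := Nat.exists_eq_add_of_le hle
        replace hm : Fintype.card V = m + d + 1 := by omega
        have h1 := numeric d m (hasIso G).card hd (by omega)
          (hasIso_bound G hd h m hm _ (Or.inl rfl)) (hasIso_bound G hd h m hm _ (Or.inr rfl))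
        rw [hm] at hdc ⊢
        refine le_trans ?_ (bern d m)
        have h2 : (((connSets G).card + (hasIso G).card + 1 : ℕ) : ℝ)
            ≤ ((2 ^ (m + d + 1) + (m + d + 1) : ℕ) : ℝ) := by exact_mod_cast hdc
        push_cast at h2
        linarith
    · refine le_trans ?_ (card_noIso G h)
      exact_mod_cast sparse G hd h hn
end
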